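/- arXiv:2310.04393 — 6 statements merged into one kernel-verified Lean document; each statement's English description precedes it below -/
import Mathlib

section
/- Let ε > 0, 0 ≤ r < s ≤ 1, Q ⊆ [0,1]^X a class of functions, μ a probability measure on X, and 0 < δ < (s−r)ε. If (a₁,…,aₙ) is a δ-approximation for Q^{r,s} with respect to μ, then the set A = {a₁,…,aₙ} is an ε-net for the fuzzy set system Q_{r,s} with respect to μ. -/
open MeasureTheory

/-- The piecewise-linear cropping function `f_{r,s} : [0,1] → [0,1]`,
`f_{r,s}(t) = r` for `t ≤ r`, `= t` for `r ≤ t ≤ s`, `= s` for `t ≥ s`. -/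
noncomputable def cropFn (r s t : ℝ) : ℝ := max r (min s t)

lemma cropFn_le_right {r s : ℝ} (hrs : r ≤ s) (t : ℝ) : cropFn r s t ≤ s :=
  max_le hrs (min_le_left s t)

lemma cropFn_of_right_le {r s t : ℝ} (hrs : r ≤ s) (ht : s ≤ t) : cropFn r s t = s := by
  rw [cropFn, min_eq_left ht, max_eq_right hrs]

lemma cropFn_of_le_left {r s t : ℝ} (ht : t ≤ r) : cropFn r s t = r :=
  max_eq_left ((min_le_right s t).trans ht)

/-- Markov's inequality for `s - cropFn r s ∘ q`. If `cropFn r s ∘ q` is not integrable, its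
integral is `0` by convention and the bound holds because `0 ≤ r`. -/
lemma integral_cropFn_le {X : Type*} [MeasurableSpace X] (μ : Measure X) [IsProbabilityMeasure μ]
    {r s : ℝ} (hr : 0 ≤ r) (hrs : r ≤ s) (q : X → ℝ) :
    ∫ x, cropFn r s (q x) ∂μ ≤ s - (s - r) * μ.real {x | q x ≤ r} := by
  by_cases hint : Integrable (fun x => cropFn r s (q x)) μ
  · have hmarkov := mul_meas_ge_le_integral_of_nonneg (μ := μ)
      (f := fun x => s - cropFn r s (q x))
      (Filter.Eventually.of_forall fun x => sub_nonneg.2 (cropFn_le_right hrs (q x)))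
      ((integrable_const s).sub hint) (s - r)
    have hmono : μ.real {x | q x ≤ r} ≤ μ.real {x | s - r ≤ s - cropFn r s (q x)} :=
      measureReal_mono fun x (hx : q x ≤ r) => by simp [cropFn_of_le_left hx]
    rw [integral_sub (integrable_const s) hint, integral_const, probReal_univ, one_smul] at hmarkov
    linarith [mul_le_mul_of_nonneg_left hmono (sub_nonneg.2 hrs)]
  · rw [integral_undef hint]
    have := mul_le_mul_of_nonneg_left (measureReal_le_one (μ := μ) (s := {x | q x ≤ r}))
      (sub_nonneg.2 hrs)
    linarith

/-- If `(a₁,…,aₙ)` is a `δ`-approximation for `Q^{r,s}` with respect to `μ` and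
`0 < δ < (s-r)ε`, then `{a₁,…,aₙ}` is an `ε`-net for the fuzzy set system
`Q_{r,s}` with respect to `μ`: for every `q ∈ Q` with `μ({q ≤ r}) ≥ ε`, some
`aᵢ` satisfies `q(aᵢ) < s` (i.e. `{a₁,…,aₙ}` is not contained in `{q ≥ s}`). -/
theorem stmt_1 {X : Type*} [MeasurableSpace X]
    (Q : Set (X → ℝ)) (hQ : ∀ q ∈ Q, ∀ x, q x ∈ Set.Icc (0 : ℝ) 1)
    (ε r s δ : ℝ) (hε : 0 < ε) (hr : 0 ≤ r) (hrs : r < s) (hs : s ≤ 1)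
    (hδ0 : 0 < δ) (hδ : δ < (s - r) * ε)
    (μ : Measure X) [IsProbabilityMeasure μ]
    (n : ℕ) (hn : 0 < n) (a : Fin n → X)
    (happrox : ∀ q ∈ Q,
      |(∑ i, cropFn r s (q (a i))) / (n : ℝ) - ∫ x, cropFn r s (q x) ∂μ| ≤ δ) :
    ∀ q ∈ Q, ENNReal.ofReal ε ≤ μ {x | q x ≤ r} → ∃ i, q (a i) < s := by
  intro q hq hμ
  by_contra! h
  have hn' : (n : ℝ) ≠ 0 := Nat.cast_ne_zero.2 hn.ne'
  have hav : (∑ i, cropFn r s (q (a i))) / (n : ℝ) = s := by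
    simp [cropFn_of_right_le hrs.le (h _), mul_div_cancel_left₀ s hn']
  have hε' : ε ≤ μ.real {x | q x ≤ r} :=
    (ENNReal.ofReal_le_iff_le_toReal (measure_ne_top μ _)).1 hμ
  have happ := (abs_le.1 (happrox q hq)).2
  rw [hav] at happ
  linarith [integral_cropFn_le μ hr hrs.le q,
    mul_le_mul_of_nonneg_left hε' (sub_nonneg.2 hrs.le)]
end

section
/- Let Q ⊆ [0,1]^X be a class of functions, 0 ≤ r < s ≤ 1, and 0 < ε < (s−r)/2. Then for every n, the shatter function of the fuzzy set system Q_{r,s} satisfies π_{Q_{r,s}}(n) ≤ N_{Q,ε}(n). -/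
open scoped ENNReal

/-- The shatter function `π_{Q_{r,s}}(n)` of the fuzzy set system
`Q_{r,s} = {({x : q x ≤ r}, {x : q x ≥ s}) : q ∈ Q}`: the maximum, over sets
`Y` of size `n`, of the number of subsets `Z ⊆ Y` with `S₊ ∩ Y = Z` and
`S₋ ∩ Y = Y \ Z` for some member `S` of the system. -/
noncomputable def fuzzyShatterFn {X : Type*} (Q : Set (X → ℝ)) (r s : ℝ) (n : ℕ) : ℕ∞ :=
  ⨆ (Y : Finset X) (_ : Y.card = n),
    (Set.ncard {Z : Set X | Z ⊆ ↑Y ∧ ∃ q ∈ Q,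
      (∀ y ∈ Y, (q y ≤ r ↔ y ∈ Z)) ∧ (∀ y ∈ Y, (s ≤ q y ↔ y ∉ Z))} : ℕ∞)

/-- The `ℓ∞` covering number `N_{Q,ε}(n) = sup_{x̄ ∈ Xⁿ} N(Q, x̄, ε)`, where
`N(Q, x̄, ε)` is the least cardinality of `A ⊆ [0,1]ⁿ` such that every point of
`Q(x̄)` is within `ℓ∞`-distance `ε` of some point of `A`. -/
noncomputable def coveringNum {X : Type*} (Q : Set (X → ℝ)) (ε : ℝ) (n : ℕ) : ℕ∞ :=
  ⨆ xs : Fin n → X, sInf {m : ℕ∞ | ∃ A : Finset (Fin n → ℝ),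
    (∀ a ∈ A, ∀ i, a i ∈ Set.Icc (0 : ℝ) 1) ∧ (A.card : ℕ∞) = m ∧
    ∀ q ∈ Q, ∃ a ∈ A, ∀ i, |a i - q (xs i)| ≤ ε}

/-- For `Q ⊆ [0,1]^X`, `0 ≤ r < s ≤ 1` and `0 < ε < (s-r)/2`, the shatter
function of `Q_{r,s}` is bounded by the covering number: `π_{Q_{r,s}}(n) ≤ N_{Q,ε}(n)`. -/
theorem stmt_3 {X : Type*} (Q : Set (X → ℝ))
    (hQ : ∀ q ∈ Q, ∀ x, q x ∈ Set.Icc (0 : ℝ) 1)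
    (r s ε : ℝ) (hr : 0 ≤ r) (hrs : r < s) (hs : s ≤ 1)
    (hε0 : 0 < ε) (hε : ε < (s - r) / 2) :
    ∀ n : ℕ, fuzzyShatterFn Q r s n ≤ coveringNum Q ε n := by
  intro n
  refine iSup₂_le fun Y hY => ?_
  let e := Y.equivFinOfCardEq hY
  refine le_trans ?_ (le_iSup _ fun i => (e.symm i : X))
  refine le_sInf ?_
  rintro _ ⟨A, -, rfl, hA⟩
  classical
  let Z : (Fin n → ℝ) → Set X := fun a => {x | ∃ i, (e.symm i : X) = x ∧ a i < (r + s) / 2}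
  have hsub : {W : Set X | W ⊆ ↑Y ∧ ∃ q ∈ Q,
      (∀ y ∈ Y, (q y ≤ r ↔ y ∈ W)) ∧ (∀ y ∈ Y, (s ≤ q y ↔ y ∉ W))} ⊆ ↑(A.image Z) := by
    rintro W ⟨hWY, q, hq, hqr, hqs⟩
    obtain ⟨a, ha, hqa⟩ := hA q hq
    rw [Finset.coe_image]
    refine ⟨a, ha, Set.ext fun x => ⟨?_, fun hx => ?_⟩⟩
    · rintro ⟨i, rfl, hi⟩
      by_contra hx
      have h₁ := (hqs _ (e.symm i).2).2 hx
      have h₂ := (abs_le.1 (hqa i)).1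
      linarith
    · have h₁ := (hqr x (hWY hx)).2 hx
      have h₂ := (abs_le.1 (hqa (e ⟨x, hWY hx⟩))).2
      simp only [Equiv.symm_apply_apply] at h₂
      exact ⟨e ⟨x, hWY hx⟩, by simp, by linarith⟩
  have hcard := Set.ncard_le_ncard hsub (Finset.finite_toSet _)
  rw [Set.ncard_coe_finset] at hcard
  exact_mod_cast hcard.trans Finset.card_image_le
end

section
/- For every d ∈ ℕ and every t > 0 there exists T = T(t,d) such that: if F is a finite fuzzy set system on a set X with VC-dimension vc(F) ≤ d, and the fractional transversal number of the inner set system satisfies τ*(F_i) ≤ t, then the transversal number of the outer set system satisfies τ(F_o) ≤ T. -/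
open scoped ENNReal

universe u

/-- A fuzzy set system `F` shatters a finite set `Y` when every subset `Z ⊆ Y`
is realized as a trace: some `S ∈ F` has `S₊ ∩ Y = Z` and `S₋ ∩ Y = Y \ Z`. -/
def FuzzyShatters {X : Type u} (F : Set (Set X × Set X)) (Y : Finset X) : Prop :=
  ∀ Z : Finset X, Z ⊆ Y → ∃ S ∈ F,
    (∀ y ∈ Y, (y ∈ S.1 ↔ y ∈ Z)) ∧ (∀ y ∈ Y, (y ∈ S.2 ↔ y ∉ Z))

/-- `f` is a fractional transversal of the set system `G`: a finitely-supported
`[0,1]`-valued weight function with total weight at least `1` on every member of `G`. -/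
def IsFracTransversal {X : Type u} (G : Set (Set X)) (f : X → ℝ) : Prop :=
  (Function.support f).Finite ∧ (∀ x, 0 ≤ f x ∧ f x ≤ 1) ∧
    ∀ S ∈ G, 1 ≤ ∑ᶠ x ∈ S, f x

/-- The fractional transversal number `τ*(G)`: the infimum of total weights of
fractional transversals (`⊤` if none exists). -/
noncomputable def fracTransversalNum {X : Type u} (G : Set (Set X)) : ℝ≥0∞ :=
  ⨅ (f : X → ℝ) (_ : IsFracTransversal G f), ENNReal.ofReal (∑ᶠ x, f x)

open Finset in
/-- If every `P k` has weight at least `1`, and every set of at most `|ι|` points lies in some `N k`,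
then the weighted number of tuples `y : ι → V` such that some `k` has `y i ∈ P k` for `i ∈ J` and
`y i ∈ N k` for `i ∉ J` is at least `(∑ v, w v) ^ |Jᶜ|`: draw the coordinates outside `J` first,
pick a `k` for them, and then draw the coordinates in `J` from `P k`. -/
lemma pow_card_compl_le_sum_prod_weight {V κ ι : Type*} [Fintype V] [Fintype ι] [DecidableEq ι]
    {w : V → ℝ} (hw : ∀ v, 0 ≤ w v) {P N : κ → Set V}
    (hP : ∀ k, 1 ≤ ∑ v, (P k).indicator w v)
    (hN : ∀ b : Finset V, #b ≤ Fintype.card ι → ∃ k, ∀ v ∈ b, v ∈ N k) (J : Finset ι) :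
    (∑ v, w v) ^ (Fintype.card ι - #J) ≤ ∑ y : ι → V,
      {y : ι → V | ∃ k, (∀ i ∈ J, y i ∈ P k) ∧ ∀ i ∉ J, y i ∈ N k}.indicator
        (fun y ↦ ∏ i, w (y i)) y := by
  classical
  let e := Equiv.piEquivPiSubtypeProd (· ∈ J) (fun _ : ι ↦ V)
  have hex (b : {i // i ∉ J} → V) : ∃ k, ∀ i, b i ∈ N k := by
    obtain ⟨k, hk⟩ := hN (univ.image b) <| card_image_le.trans <| by
      rw [card_univ]
      exact Fintype.card_subtype_le _
    exact ⟨k, fun i ↦ hk _ (mem_image_of_mem _ (mem_univ i))⟩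
  choose k hk using hex
  rw [← e.symm.sum_comp, Fintype.sum_prod_type_right]
  have hcard : Fintype.card ι - #J = #(univ : Finset {i // i ∉ J}) := by
    rw [card_univ, Fintype.card_subtype_compl]
    simp
  rw [hcard, ← prod_const, Fintype.prod_sum]
  refine sum_le_sum fun b _ ↦ ?_
  have hb : 0 ≤ ∏ i, w (b i) := prod_nonneg fun i _ ↦ hw _
  calc ∏ i, w (b i)
    _ ≤ (∏ i, w (b i)) * ∏ _i : {i // i ∈ J}, ∑ v, (P (k b)).indicator w v :=
        le_mul_of_one_le_right hb <| by
          rw [prod_const]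
          exact one_le_pow₀ (hP _)
    _ = ∑ a : {i // i ∈ J} → V, (∏ i, w (b i)) * ∏ i, (P (k b)).indicator w (a i) := by
        rw [Fintype.prod_sum, mul_sum]
    _ ≤ _ := sum_le_sum fun a _ ↦ ?_
  have hsymm : e (e.symm (a, b)) = (a, b) := e.apply_symm_apply _
  have ha (i : {i // i ∈ J}) : e.symm (a, b) i = a i := congrFun (congrArg Prod.fst hsymm) i
  have hb' (i : {i // i ∉ J}) : e.symm (a, b) i = b i := congrFun (congrArg Prod.snd hsymm) i
  by_cases h : ∀ i, a i ∈ P (k b)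
  · rw [Set.indicator_of_mem]
    · rw [← Fintype.prod_subtype_mul_prod_subtype (· ∈ J), mul_comm]
      simp only [ha, hb', h, Set.indicator_of_mem]
      exact le_of_eq (by congr!)
    · exact ⟨k b, fun i hi ↦ ha ⟨i, hi⟩ ▸ h _, fun i hi ↦ hb' ⟨i, hi⟩ ▸ hk b _⟩
  · obtain ⟨i, hi⟩ := not_forall.1 h
    rw [prod_eq_zero (mem_univ i) (Set.indicator_of_notMem hi _), mul_zero]
    exact Set.indicator_nonneg (fun y _ ↦ prod_nonneg fun i _ ↦ hw _) _

open Finset in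
/-- The Sauer–Shelah bound for the traces of a fuzzy set system on a tuple of points. -/
lemma card_traces_le_of_not_fuzzyShatters {X ι : Type*} [Fintype ι] {F : Set (Set X × Set X)}
    (hdisj : ∀ S ∈ F, Disjoint S.1 S.2) {d : ℕ}
    (hvc : ∀ Y : Finset X, #Y = d + 1 → ¬ FuzzyShatters F Y) (y : ι → X) (𝒜 : Finset (Finset ι))
    (h𝒜 : ∀ J ∈ 𝒜, ∃ S ∈ F, (∀ i ∈ J, y i ∈ S.1) ∧ ∀ i ∉ J, y i ∈ S.2) :
    #𝒜 ≤ ∑ k ∈ Iic d, (Fintype.card ι).choose k := by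
  classical
  refine (card_le_card_shatterer 𝒜).trans <| card_shatterer_le_sum_vcDim.trans <|
    sum_le_sum_of_subset <| Iic_subset_Iic.2 ?_
  by_contra! hd
  obtain ⟨I', hI', hcard'⟩ := Finset.lt_sup_iff.1 hd
  obtain ⟨I, hII', hcard⟩ := exists_subset_card_eq (Nat.succ_le_of_lt hcard')
  have hI : 𝒜.Shatters I := (mem_shatterer.1 hI').mono_right hII'
  have hnot {S} (hS : S ∈ F) {x} (h1 : x ∈ S.1) (h2 : x ∈ S.2) : False :=
    Set.disjoint_left.1 (hdisj S hS) h1 h2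
  have htrace (Z : Finset ι) (hZ : Z ⊆ I) : ∃ S ∈ F, (∀ i ∈ I, i ∈ Z → y i ∈ S.1) ∧
      ∀ i ∈ I, i ∉ Z → y i ∈ S.2 := by
    obtain ⟨J, hJ, rfl⟩ := hI hZ
    obtain ⟨S, hS, h1, h2⟩ := h𝒜 J hJ
    exact ⟨S, hS, fun i _ hi ↦ h1 i (mem_inter.1 hi).2,
      fun i hiI hi ↦ h2 i fun hiJ ↦ hi (mem_inter.2 ⟨hiI, hiJ⟩)⟩
  have hinj : Set.InjOn y I := by
    intro i hi j hj hij
    by_contra hne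
    obtain ⟨S, hS, h1, h2⟩ := htrace {i} (singleton_subset_iff.2 hi)
    exact hnot hS (h1 i hi (mem_singleton_self i))
      (hij ▸ h2 j hj fun h ↦ hne (mem_singleton.1 h).symm)
  refine hvc (I.image y) ((card_image_of_injOn hinj).trans hcard) fun Z hZ ↦ ?_
  obtain ⟨S, hS, h1, h2⟩ := htrace {i ∈ I | y i ∈ Z} (filter_subset _ _)
  refine ⟨S, hS, ?_, ?_⟩ <;> simp only [mem_image, forall_exists_index, and_imp] <;>
    rintro _ i hi rfl <;> have h1i := h1 i hi <;> have h2i := h2 i hi <;>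
    simp only [mem_filter, hi, true_and] at h1i h2i
  · exact ⟨fun h ↦ by_contra fun hz ↦ hnot hS h (h2i hz), h1i⟩
  · exact ⟨fun h hz ↦ hnot hS (h1i hz) h, h2i⟩

open Finset in
/-- If no set of at most `n` points is a transversal of the outer set system, then a weight on a
finite type of points giving every inner set weight at least `1` has total weight `W` with
`(1 + W) ^ n ≤ W ^ n * ∑ k ≤ d, n.choose k`. -/
lemma one_add_pow_le_of_forall_not_transversal {X V : Type*} [Fintype V]
    {F : Set (Set X × Set X)} (hdisj : ∀ S ∈ F, Disjoint S.1 S.2) {d n : ℕ}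
    (hvc : ∀ Y : Finset X, #Y = d + 1 → ¬ FuzzyShatters F Y) (p : V → X) {w : V → ℝ}
    (hw : ∀ v, 0 ≤ w v) (hP : ∀ S ∈ F, 1 ≤ ∑ v, (p ⁻¹' S.1).indicator w v)
    (hA : ∀ A : Finset X, #A ≤ n → ∃ S ∈ F, ∀ a ∈ A, a ∈ S.2) :
    (1 + ∑ v, w v) ^ n ≤ (∑ v, w v) ^ n * ∑ k ∈ Iic d, (n.choose k : ℝ) := by
  classical
  let R (y : Fin n → V) (J : Finset (Fin n)) : Prop :=
    ∃ k : F, (∀ i ∈ J, y i ∈ p ⁻¹' k.1.1) ∧ ∀ i ∉ J, y i ∈ p ⁻¹' k.1.2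
  have hlow (J : Finset (Fin n)) : (∑ v, w v) ^ (n - #J) ≤
      ∑ y : Fin n → V, {y | R y J}.indicator (fun y ↦ ∏ i, w (y i)) y := by
    have := pow_card_compl_le_sum_prod_weight (κ := F) hw (P := fun k ↦ p ⁻¹' k.1.1)
      (N := fun k ↦ p ⁻¹' k.1.2) (fun k ↦ hP k.1 k.2) (ι := Fin n) (fun b hb ↦ ?_) J
    · simpa only [Fintype.card_fin] using this
    · obtain ⟨S, hS, h⟩ := hA (b.image p) (card_image_le.trans (by simpa using hb))
      exact ⟨⟨S, hS⟩, fun v hv ↦ h _ (mem_image_of_mem p hv)⟩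
  have hup (y : Fin n → V) : (#{J | R y J} : ℝ) ≤ ∑ k ∈ Iic d, (n.choose k : ℝ) := by
    have := card_traces_le_of_not_fuzzyShatters hdisj hvc (fun i ↦ p (y i)) {J | R y J} <| by
      intro J hJ
      obtain ⟨k, hk⟩ := (mem_filter.1 hJ).2
      exact ⟨k.1, k.2, hk⟩
    rw [Fintype.card_fin] at this
    exact_mod_cast this
  calc (1 + ∑ v, w v) ^ n
    _ = ∑ J : Finset (Fin n), (∑ v, w v) ^ (n - #J) := by
        simp [← Fin.sum_pow_mul_eq_add_pow]
    _ ≤ ∑ J, ∑ y : Fin n → V, {y | R y J}.indicator (fun y ↦ ∏ i, w (y i)) y :=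
        sum_le_sum fun J _ ↦ hlow J
    _ = ∑ y : Fin n → V, (∏ i, w (y i)) * #{J | R y J} := by
        rw [sum_comm]
        refine sum_congr rfl fun y _ ↦ ?_
        simp [Set.indicator_apply, ← sum_filter, mul_comm]
    _ ≤ ∑ y : Fin n → V, (∏ i, w (y i)) * ∑ k ∈ Iic d, (n.choose k : ℝ) :=
        sum_le_sum fun y _ ↦ mul_le_mul_of_nonneg_left (hup y) (prod_nonneg fun i _ ↦ hw _)
    _ = (∑ v, w v) ^ n * ∑ k ∈ Iic d, (n.choose k : ℝ) := by
        rw [← sum_mul, Fintype.sum_pow]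

open Finset Filter in
lemma exists_sum_choose_lt_pow (d : ℕ) {r : ℝ} (hr : 1 < r) :
    ∃ n : ℕ, ∑ k ∈ Iic d, (n.choose k : ℝ) < r ^ n := by
  have hlim := (tendsto_pow_const_div_const_pow_of_one_lt d hr).const_mul ((d : ℝ) + 1)
  rw [mul_zero] at hlim
  obtain ⟨n, hn, hn1⟩ := ((hlim.eventually_lt_const one_pos).and (eventually_ge_atTop 1)).exists
  have hpos : 0 < r ^ n := by positivity
  refine ⟨n, lt_of_le_of_lt ?_ ((div_lt_one hpos).1 (by rwa [mul_div_assoc]) :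
    ((d : ℝ) + 1) * n ^ d < r ^ n)⟩
  calc ∑ k ∈ Iic d, (n.choose k : ℝ)
    _ ≤ ∑ _k ∈ Iic d, (n : ℝ) ^ d := sum_le_sum fun k hk ↦ by
        exact_mod_cast (Nat.choose_le_pow n k).trans (Nat.pow_le_pow_right hn1 (mem_Iic.1 hk))
    _ = ((d : ℝ) + 1) * n ^ d := by simp

/-- For every `d ∈ ℕ` and `t > 0` there is `T = T(t,d)` such that: every finite
fuzzy set system `F` of VC-dimension at most `d` with `τ*(F_i) ≤ t` satisfies
`τ(F_o) ≤ T`, i.e. there is a transversal of the outer set system of size at most `T`. -/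
theorem stmt_5 (d : ℕ) (t : ℝ) (ht : 0 < t) :
    ∃ T : ℕ, ∀ (X : Type u) (F : Set (Set X × Set X)),
      F.Finite → (∀ S ∈ F, Disjoint S.1 S.2) →
      (∀ Y : Finset X, Y.card = d + 1 → ¬ FuzzyShatters F Y) →
      fracTransversalNum (Prod.fst '' F) ≤ ENNReal.ofReal t →
      ∃ A : Finset X, A.card ≤ T ∧ ∀ S ∈ F, ∃ a ∈ A, a ∉ S.2 := by
  obtain ⟨n, hn⟩ := exists_sum_choose_lt_pow d (r := 1 + 1 / (t + 1))
    (lt_add_of_pos_right _ (by positivity))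
  refine ⟨n, fun X F _ hdisj hvc hτ ↦ ?_⟩
  by_contra! hA
  obtain ⟨f, hf, hft⟩ : ∃ f, IsFracTransversal (Prod.fst '' F) f ∧ ∑ᶠ x, f x < t + 1 := by
    have hlt : fracTransversalNum (Prod.fst '' F) < ENNReal.ofReal (t + 1) :=
      hτ.trans_lt ((ENNReal.ofReal_lt_ofReal_iff (by positivity)).2 (lt_add_one t))
    simp only [fracTransversalNum, iInf_lt_iff] at hlt
    obtain ⟨f, hf, h⟩ := hlt
    exact ⟨f, hf, (ENNReal.ofReal_lt_ofReal_iff (by positivity)).1 h⟩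
  obtain ⟨hfin, hf01, hF⟩ := hf
  let s := hfin.toFinset
  have hsum (g : X → ℝ) (hg : Function.support g ⊆ Function.support f) :
      ∑ᶠ x, g x = ∑ v : s, g v := by
    rw [finsum_eq_sum_of_support_subset g (s := s) (by simpa [s] using hg), Finset.sum_coe_sort]
  have hP (S) (hS : S ∈ F) :
      1 ≤ ∑ v : s, (Subtype.val ⁻¹' S.1).indicator (fun v : s ↦ f v) v := by
    have h := hF S.1 ⟨S, hS, rfl⟩
    rw [finsum_mem_def, hsum _ (by simp)] at h
    exact h
  have key := one_add_pow_le_of_forall_not_transversal hdisj hvc (fun v : s ↦ (v : X))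
    (fun v ↦ (hf01 v).1) hP hA
  rw [← hsum f subset_rfl] at key
  set W := ∑ᶠ x, f x
  have hW : 0 < W := by
    obtain ⟨S, hS, -⟩ := hA ∅ (by simp)
    refine one_pos.trans_le ((hP S hS).trans ?_)
    rw [show W = ∑ v : s, f v from hsum f subset_rfl]
    exact Finset.sum_le_sum fun v _ ↦ Set.indicator_le_self' (fun v _ ↦ (hf01 v).1) v
  refine absurd key (not_le.2 ?_)
  calc W ^ n * ∑ k ∈ Finset.Iic d, (n.choose k : ℝ)
    _ < W ^ n * (1 + 1 / (t + 1)) ^ n := by gcongr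
    _ ≤ W ^ n * (1 + 1 / W) ^ n := by gcongr
    _ = (1 + W) ^ n := by
        rw [← mul_pow]
        congr 1
        field_simp
        ring
end

section
/- For all natural numbers p ≥ q ≥ d + 1 there exists N = N(p,q,d) such that: if F is a finite fuzzy set system with dual VC-dimension vc*(F) ≤ d, and the inner set system F_i has the (p,q)-property, then the fractional transversal number of the outer set system satisfies τ*(F_o) ≤ N. -/
open scoped ENNReal

universe u

/-- The dual fuzzy set system `F*` of a fuzzy set system `F` shatters a finite
collection `G` of members of `F` when every sub-collection `W ⊆ G` is realized
as a trace by some point `x`: `x ∈ S₊` exactly for `S ∈ W` and `x ∈ S₋` exactly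
for `S ∈ G ∖ W`. -/
def DualShatters {X : Type u} (F : Set (Set X × Set X))
    (G : Finset (Set X × Set X)) : Prop :=
  ↑G ⊆ F ∧ ∀ W ⊆ G, ∃ x : X,
    (∀ S ∈ G, (x ∈ S.1 ↔ S ∈ W)) ∧ (∀ S ∈ G, (x ∈ S.2 ↔ S ∉ W))

/-- **Minimax theorem** for a nonnegative matrix game: if every mixed strategy `w` of the column
player admits a row of value at least `β`, then some mixed strategy of the row player guarantees
value at least `β`. -/
theorem exists_stdSimplex_le_sum_mul {R ι : Type*} [Fintype R] [Nonempty R] [Fintype ι]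
    (A : R → ι → ℝ) (hA : ∀ x S, 0 ≤ A x S) (β : ℝ)
    (h : ∀ w ∈ stdSimplex ℝ ι, ∃ x, β ≤ ∑ S, w S * A x S) :
    ∃ t ∈ stdSimplex ℝ R, ∀ S, β ≤ ∑ x, t x * A x S := by
  classical
  by_contra! hcon
  let L : (R → ℝ) →ₗ[ℝ] (ι → ℝ) := Matrix.vecMulLinear (Matrix.of A)
  have hL : ∀ t S, L t S = ∑ x, t x * A x S := fun t S => rfl
  have hLc : Continuous L := L.continuous_of_finiteDimensional
  obtain ⟨g, u, v, hgu, huv, hgv⟩ := geometric_hahn_banach_compact_closed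
    (s := L '' stdSimplex ℝ R) (t := Set.Ici (fun _ : ι => β))
    ((convex_stdSimplex ℝ R).linear_image L) ((isCompact_stdSimplex ℝ R).image hLc)
    (convex_Ici _) isClosed_Ici (by
      rw [Set.disjoint_left]
      rintro _ ⟨t, ht, rfl⟩ hmem
      obtain ⟨S, hS⟩ := hcon t ht
      exact absurd (hmem S) (not_le.2 (by rw [hL]; exact hS)))
  set c : ι → ℝ := fun S => g (Pi.single S 1) with hc
  have hg : ∀ y : ι → ℝ, g y = ∑ S, c S * y S := by
    intro y
    conv_lhs => rw [pi_eq_sum_univ' y]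
    rw [map_sum]
    refine Finset.sum_congr rfl fun S _ => ?_
    rw [map_smul, smul_eq_mul, mul_comm, hc]
  have hβ : v < g (fun _ => β) := hgv _ (Set.mem_Ici.2 le_rfl)
  have hc0 : ∀ S, 0 ≤ c S := by
    intro S
    by_contra! hneg
    have hr : 0 ≤ (g (fun _ => β) - v) / (- c S) := div_nonneg (by linarith) (by linarith)
    have hlt := hgv ((fun _ => β) + ((g (fun _ => β) - v) / (- c S)) • Pi.single S 1) (by
      rw [Set.mem_Ici]
      refine le_add_of_nonneg_right (smul_nonneg hr ?_)
      exact Pi.single_nonneg.2 zero_le_one)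
    rw [map_add, map_smul, smul_eq_mul] at hlt
    have : (g (fun _ => β) - v) / (- c S) * c S = - (g (fun _ => β) - v) := by
      rw [div_neg, neg_mul, div_mul_cancel₀ _ hneg.ne]
    change v < _ + _ * c S at hlt
    linarith
  have hrow : ∀ x, ∑ S, c S * A x S < β * ∑ S, c S := by
    intro x
    have h1 := hgu (L (Pi.single x 1)) ⟨_, single_mem_stdSimplex ℝ x, rfl⟩
    have h2 : L (Pi.single x 1) = A x := by
      ext S
      rw [hL]
      simp [Pi.single_apply]
    rw [h2, hg] at h1
    rw [hg, ← Finset.sum_mul] at hβ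
    linarith
  have hsum : 0 < ∑ S, c S := by
    refine lt_of_le_of_ne (Finset.sum_nonneg fun S _ => hc0 S) fun h0 => ?_
    obtain ⟨x⟩ := ‹Nonempty R›
    have h1 := hrow x
    rw [← h0, mul_zero] at h1
    exact absurd h1 (not_lt.2 (Finset.sum_nonneg fun S _ => mul_nonneg (hc0 S) (hA x S)))
  obtain ⟨x, hx⟩ := h (fun S => c S / ∑ S, c S)
    ⟨fun S => div_nonneg (hc0 S) hsum.le, by rw [← Finset.sum_div, div_self hsum.ne']⟩
  have h2 : ∑ S, c S / (∑ S, c S) * A x S = (∑ S, c S * A x S) / ∑ S, c S := by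
    rw [Finset.sum_div]
    exact Finset.sum_congr rfl fun S _ => by ring
  rw [h2, le_div_iff₀ hsum] at hx
  exact absurd (hrow x) (not_lt.2 hx)

/-- Under a product weight, averaging out the coordinate `j` first bounds the weight of a set of
tuples. -/
theorem sum_prod_mul_le {ι : Type*} [Fintype ι] {n : ℕ} (w : ι → ℝ) (hw : w ∈ stdSimplex ℝ ι)
    (j : Fin (n + 1)) (φ : (Fin (n + 1) → ι) → ℝ) (β : ℝ)
    (h : ∀ f : Fin n → ι, ∑ s, w s * φ (j.insertNth s f) ≤ β) :
    ∑ f : Fin (n + 1) → ι, (∏ i, w (f i)) * φ f ≤ β := by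
  classical
  rw [← (Fin.insertNthEquiv (fun _ => ι) j).sum_comp, Fintype.sum_prod_type_right]
  calc _ = ∑ f : Fin n → ι, (∏ i, w (f i)) * ∑ s, w s * φ (j.insertNth s f) := by
        refine Finset.sum_congr rfl fun f _ => ?_
        rw [Finset.mul_sum]
        refine Finset.sum_congr rfl fun s _ => ?_
        rw [Fin.prod_univ_succAbove _ j]
        have he : Fin.insertNthEquiv (fun _ => ι) j (s, f) = j.insertNth s f := rfl
        simp only [he, Fin.insertNth_apply_same, Fin.insertNth_apply_succAbove]
        ring
    _ ≤ ∑ f : Fin n → ι, (∏ i, w (f i)) * β :=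
        Finset.sum_le_sum fun f _ =>
          mul_le_mul_of_nonneg_left (h f) (Finset.prod_nonneg fun i _ => hw.1 _)
    _ = β := by
        rw [← Finset.sum_mul, ← Fintype.sum_pow, hw.2, one_pow, one_mul]

/-- If every point has small weight in the outer sets `(M s)ᶜ`, then there is a tuple `f` of
fuzzy sets such that every intersecting subfamily of inner sets has a common point that is
outside all the other outer sets. -/
theorem exists_tuple_isolated_points {X ι : Type*} [Nonempty X] [Fintype ι] (P M : ι → Set X)
    (n : ℕ) (w : ι → ℝ) (hw : w ∈ stdSimplex ℝ ι)
    (h : ∀ x, ∑ s, w s * (M s)ᶜ.indicator 1 x ≤ 1 / (2 ^ (n + 1) * (n + 1) + 1)) :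
    ∃ f : Fin (n + 1) → ι, ∀ I : Finset (Fin (n + 1)), (⋂ i ∈ I, P (f i)).Nonempty →
      ∃ x, (∀ i ∈ I, x ∈ P (f i)) ∧ ∀ j ∉ I, x ∈ M (f j) := by
  classical
  let c : Set X → X := fun A => if hA : A.Nonempty then hA.some else Classical.arbitrary X
  have hc : ∀ A : Set X, A.Nonempty → c A ∈ A := fun A hA => by
    simp only [c, dif_pos hA]
    exact hA.some_mem
  let φ : Finset (Fin (n + 1)) → Fin (n + 1) → (Fin (n + 1) → ι) → ℝ := fun I j f =>
    if j ∉ I then (M (f j))ᶜ.indicator 1 (c (⋂ i ∈ I, P (f i))) else 0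
  set β : ℝ := 1 / (2 ^ (n + 1) * (n + 1) + 1) with hβ
  have hβ0 : 0 ≤ β := by positivity
  have hφ : ∀ I j, ∑ f : Fin (n + 1) → ι, (∏ i, w (f i)) * φ I j f ≤ β := by
    intro I j
    by_cases hj : j ∈ I
    · simpa [φ, hj] using hβ0
    refine sum_prod_mul_le w hw j _ β fun f => ?_
    have hmem : ∀ s s' i, i ∈ I → (j.insertNth s f : Fin (n + 1) → ι) i =
        (j.insertNth s' f : Fin (n + 1) → ι) i := by
      intro s s' i hi
      obtain ⟨k, rfl⟩ := Fin.exists_succAbove_eq (x := i) (y := j) (fun e => hj (e ▸ hi))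
      simp
    have hset : ∃ B : Set X, ∀ s, ⋂ i ∈ I, P ((j.insertNth s f : Fin (n + 1) → ι) i) = B := by
      rcases isEmpty_or_nonempty ι with hι | ⟨⟨s'⟩⟩
      · exact ⟨∅, fun s => isEmptyElim s⟩
      · exact ⟨_, fun s => Set.iInter₂_congr fun i hi => by rw [hmem s s' i hi]⟩
    obtain ⟨B, hB⟩ := hset
    simpa [φ, hj, hB] using h (c B)
  by_contra! hcon
  have hφ0 : ∀ I j f, 0 ≤ φ I j f := by
    intro I j f
    simp only [φ]
    split_ifs
    · exact le_rfl
    · exact Set.indicator_nonneg (fun _ _ => zero_le_one) _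
  have hone : ∀ f, 1 ≤ ∑ I, ∑ j, φ I j f := by
    intro f
    obtain ⟨I, hI, hx⟩ := hcon f
    have hcI := hc _ hI
    obtain ⟨j, hj, hjM⟩ := hx _ fun i hi => Set.mem_iInter₂.1 hcI i hi
    calc (1 : ℝ) = φ I j f := by simp [φ, hj, hjM]
      _ ≤ ∑ j, φ I j f :=
        Finset.single_le_sum (fun j _ => hφ0 I j f) (Finset.mem_univ j)
      _ ≤ _ := Finset.single_le_sum (f := fun I => ∑ j, φ I j f)
        (fun I _ => Finset.sum_nonneg fun j _ => hφ0 I j f) (Finset.mem_univ I)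
  have htot : (1 : ℝ) ≤ 2 ^ (n + 1) * (n + 1) * β :=
    calc (1 : ℝ) = ∑ f : Fin (n + 1) → ι, ∏ i, w (f i) := by
          rw [← Fintype.sum_pow, hw.2, one_pow]
      _ ≤ ∑ f : Fin (n + 1) → ι, (∏ i, w (f i)) * ∑ I, ∑ j, φ I j f :=
          Finset.sum_le_sum fun f _ =>
            le_mul_of_one_le_right (Finset.prod_nonneg fun i _ => hw.1 _) (hone f)
      _ = ∑ I, ∑ j, ∑ f : Fin (n + 1) → ι, (∏ i, w (f i)) * φ I j f := by
          simp_rw [Finset.mul_sum]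
          rw [Finset.sum_comm]
          exact Finset.sum_congr rfl fun I _ => Finset.sum_comm
      _ ≤ ∑ _I : Finset (Fin (n + 1)), ∑ _j : Fin (n + 1), β :=
          Finset.sum_le_sum fun I _ => Finset.sum_le_sum fun j _ => hφ I j
      _ = 2 ^ (n + 1) * (n + 1) * β := by simp [mul_assoc]
  rw [hβ, mul_one_div, le_div_iff₀ (by positivity)] at htot
  linarith

/-- A tuple of fuzzy sets with an intersecting inner subfamily `T`, all of whose subfamilies have
a common inner point isolated from the other outer sets, is dually shattered on `T`. -/
theorem exists_dualShatters_of_isolated {X : Type u} {F : Set (Set X × Set X)}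
    (hdisj : ∀ S ∈ F, Disjoint S.1 S.2) {m : ℕ} (f : Fin m → Set X × Set X)
    (hf : ∀ i, f i ∈ F)
    (hiso : ∀ I : Finset (Fin m), (⋂ i ∈ I, (f i).1).Nonempty →
      ∃ x, (∀ i ∈ I, x ∈ (f i).1) ∧ ∀ j ∉ I, x ∈ (f j).2)
    (T : Finset (Fin m)) (hT : (⋂ i ∈ T, (f i).1).Nonempty) :
    ∃ G : Finset (Set X × Set X), G.card = T.card ∧ DualShatters F G := by
  classical
  have hsub : ∀ W ⊆ T, ∃ x, (∀ i ∈ W, x ∈ (f i).1) ∧ ∀ j ∉ W, x ∈ (f j).2 := fun W hW =>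
    hiso W (hT.mono (Set.biInter_subset_biInter_left hW))
  have hnot : ∀ i x, x ∈ (f i).1 → x ∉ (f i).2 := fun i x =>
    fun h => Set.disjoint_left.1 (hdisj _ (hf i)) h
  have hinj : Set.InjOn f T := by
    intro i hi j _ hij
    by_contra hne
    obtain ⟨x, hx1, hx2⟩ := hsub {i} (Finset.singleton_subset_iff.2 hi)
    have h1 := hx1 i (Finset.mem_singleton_self i)
    have h2 := hx2 j (fun h => hne (Finset.mem_singleton.1 h).symm)
    exact hnot i x h1 (hij ▸ h2)
  refine ⟨T.image f, Finset.card_image_of_injOn hinj, ?_, fun W _ => ?_⟩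
  · intro S hS
    obtain ⟨i, -, rfl⟩ := Finset.mem_image.1 (Finset.mem_coe.1 hS)
    exact hf i
  obtain ⟨x, hx1, hx2⟩ := hsub (T.filter fun i => f i ∈ W) (Finset.filter_subset _ _)
  refine ⟨x, fun S hS => ?_, fun S hS => ?_⟩ <;>
  obtain ⟨i, hi, rfl⟩ := Finset.mem_image.1 hS <;>
  by_cases hW : f i ∈ W
  · simp [hW, hx1 i (Finset.mem_filter.2 ⟨hi, hW⟩)]
  · have h2 := hx2 i (fun h => hW (Finset.mem_filter.1 h).2)
    simp only [hW, iff_false]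
    exact fun h => hnot i x h h2
  · simp [hW, hnot i x (hx1 i (Finset.mem_filter.2 ⟨hi, hW⟩))]
  · simp [hW, hx2 i (fun h => hW (Finset.mem_filter.1 h).2)]

/-- A probability weight giving every member of `G` mass at least `β` bounds the fractional
transversal number by `1 / β`. -/
theorem fracTransversalNum_le_of_weight {X : Type u} {G : Set (Set X)} (R : Finset X)
    (t : X → ℝ) (ht0 : ∀ x, 0 ≤ t x) (ht1 : ∑ x ∈ R, t x = 1) {β : ℝ} (hβ : 0 < β)
    (h : ∀ S ∈ G, β ≤ ∑ x ∈ R, t x * S.indicator 1 x) :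
    fracTransversalNum G ≤ ENNReal.ofReal (1 / β) := by
  classical
  let f : X → ℝ := fun x => if x ∈ R then min 1 (t x / β) else 0
  have hf0 : ∀ x, 0 ≤ f x := fun x => by
    simp only [f]
    split_ifs
    · exact le_min zero_le_one (div_nonneg (ht0 x) hβ.le)
    · exact le_rfl
  have hsupp : Function.support f ⊆ R := fun x hx => by
    by_contra hxR
    exact hx (if_neg hxR)
  have hft : IsFracTransversal G f := by
    refine ⟨R.finite_toSet.subset hsupp, fun x => ⟨hf0 x, ?_⟩, fun S hS => ?_⟩
    · simp only [f]
      split_ifs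
      · exact min_le_left _ _
      · exact zero_le_one
    have hsum : ∑ᶠ x ∈ S, f x = ∑ x ∈ R, S.indicator f x := by
      rw [finsum_mem_def]
      refine finsum_eq_sum_of_support_subset _ ?_
      rw [Set.support_indicator]
      exact Set.inter_subset_right.trans hsupp
    rw [hsum]
    have hi0 : ∀ x ∈ R, 0 ≤ S.indicator f x := fun x _ =>
      Set.indicator_nonneg (fun x _ => hf0 x) x
    by_cases hbig : ∃ x ∈ R, x ∈ S ∧ 1 ≤ t x / β
    · obtain ⟨x, hxR, hxS, hx⟩ := hbig
      refine le_trans ?_ (Finset.single_le_sum hi0 hxR)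
      simp [f, hxS, hxR, hx]
    · push Not at hbig
      have h1 : ∑ x ∈ R, S.indicator f x = (∑ x ∈ R, t x * S.indicator 1 x) / β := by
        rw [Finset.sum_div]
        refine Finset.sum_congr rfl fun x hx => ?_
        by_cases hxS : x ∈ S
        · simp [f, hxS, hx, (hbig x hx hxS).le]
        · simp [hxS]
      rw [h1, le_div_iff₀ hβ, one_mul]
      exact h S hS
  refine (iInf₂_le f hft).trans (ENNReal.ofReal_le_ofReal ?_)
  rw [finsum_eq_sum_of_support_subset f hsupp, ← ht1, Finset.sum_div]
  refine Finset.sum_le_sum fun x hx => ?_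
  simp only [f, if_pos hx]
  exact min_le_right _ _

/-- Fuzzy (p,q)-theorem: for all `p ≥ q ≥ d + 1` there is `N = N(p,q,d)` such
that every finite fuzzy set system `F` with dual VC-dimension at most `d`
(no `(d+1)`-element subcollection is dually shattered) whose inner set system
`F_i` has the `(p,q)`-property satisfies `τ*(F_o) ≤ N`. -/
theorem stmt_7 (p q d : ℕ) (hq : d + 1 ≤ q) (hpq : q ≤ p) :
    ∃ N : ℝ, ∀ (X : Type u) (F : Set (Set X × Set X)),
      F.Finite → (∀ S ∈ F, Disjoint S.1 S.2) →
      (∀ G : Finset (Set X × Set X), G.card = d + 1 → ¬ DualShatters F G) →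
      (∀ f : Fin p → Set X × Set X, (∀ i, f i ∈ F) →
        ∃ I : Finset (Fin p), I.card = q ∧ (⋂ i ∈ I, (f i).1).Nonempty) →
      fracTransversalNum ((fun S : Set X × Set X => S.2ᶜ) '' F) ≤
        ENNReal.ofReal N := by
  classical
  obtain ⟨n, rfl⟩ : ∃ n, p = n + 1 := ⟨p - 1, by omega⟩
  set β : ℝ := 1 / (2 ^ (n + 1) * (n + 1) + 1) with hβ
  have hβ0 : 0 < β := by positivity
  refine ⟨1 / β, fun X F hF hdisj hvc hpq' => ?_⟩
  rcases F.eq_empty_or_nonempty with rfl | ⟨S₀, hS₀⟩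
  · refine (iInf₂_le (fun _ => 0) ⟨by simp, by simp, by simp⟩).trans ?_
    simp
  have : Nonempty X := by
    obtain ⟨I, -, x, -⟩ := hpq' (fun _ => S₀) fun _ => hS₀
    exact ⟨x⟩
  have := hF.fintype
  have hcover : ∃ R : Finset X, ∀ x, ∃ y ∈ R, ∀ S : F, x ∈ S.1.2 ↔ y ∈ S.1.2 := by
    let v : X → Set F := fun x => {S | x ∈ S.1.2}
    refine ⟨(Set.finite_range fun a : Set.range v => a.2.choose).toFinset, fun x => ?_⟩
    refine ⟨_, (Set.Finite.mem_toFinset _).2 ⟨⟨v x, x, rfl⟩, rfl⟩, fun S => ?_⟩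
    have hv : v (Exists.choose (⟨x, rfl⟩ : v x ∈ Set.range v)) = v x :=
      Exists.choose_spec (⟨x, rfl⟩ : v x ∈ Set.range v)
    exact (Set.ext_iff.1 hv S).symm
  obtain ⟨R, hR⟩ := hcover
  have : Nonempty R := by
    obtain ⟨y, hy, -⟩ := hR (Classical.arbitrary X)
    exact ⟨⟨y, hy⟩⟩
  obtain ⟨t, ht, htβ⟩ := exists_stdSimplex_le_sum_mul
    (fun (x : R) (S : F) => (S.1.2)ᶜ.indicator (1 : X → ℝ) x)
    (fun x S => Set.indicator_nonneg (fun _ _ => zero_le_one) _) β (by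
      intro w hw
      by_contra! hcon
      obtain ⟨f, hf⟩ := exists_tuple_isolated_points (fun S : F => S.1.1) (fun S : F => S.1.2)
        n w hw (by
          intro x
          obtain ⟨y, hy, hxy⟩ := hR x
          refine le_trans (le_of_eq ?_) (hcon ⟨y, hy⟩).le
          refine Finset.sum_congr rfl fun S _ => ?_
          simp [Set.indicator_apply, hxy S])
      obtain ⟨I, hIq, hI⟩ := hpq' (fun i => f i) fun i => (f i).2
      obtain ⟨T, hTI, hTd⟩ := Finset.exists_subset_card_eq (hq.trans hIq.ge)
      obtain ⟨G, hG, hGs⟩ := exists_dualShatters_of_isolated hdisj (fun i => (f i).1)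
        (fun i => (f i).2) hf T (hI.mono (Set.biInter_subset_biInter_left hTI))
      exact hvc G (hG.trans hTd) hGs)
  let t' : X → ℝ := fun x => if hx : x ∈ R then t ⟨x, hx⟩ else 0
  have ht' : ∀ x : R, t' x = t x := fun x => dif_pos x.2
  refine fracTransversalNum_le_of_weight R t' (fun x => ?_) ?_ hβ0 ?_
  · simp only [t']
    split_ifs
    · exact ht.1 _
    · exact le_rfl
  · rw [← Finset.sum_coe_sort, ← ht.2]
    exact Finset.sum_congr rfl fun x _ => ht' x
  · rintro _ ⟨S, hS, rfl⟩
    rw [← Finset.sum_coe_sort]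
    simpa only [ht'] using htβ ⟨S, hS⟩
end

section
/- For all 0 ≤ r < t < s ≤ 1, all d₁, d₂ ∈ ℕ, and all p ≥ q ≥ d₁ + 1, there exists N = N(d₁,d₂,p,q) ∈ ℕ such that: if Q ⊆ [0,1]^X is a finite class of functions with vc*(Q_{r,t}) ≤ d₁ and vc(Q_{t,s}) ≤ d₂, and the set system Q_{≤r} = {{x : q(x) ≤ r} : q ∈ Q} has the (p,q)-property, then the transversal number of the set system Q_{<s} = {{x : q(x) < s} : q ∈ Q} satisfies τ(Q_{<s}) ≤ N. -/
universe u

/-- The fuzzy set system `Q_{a,b} = {({x : q x ≤ a}, {x : q x ≥ b}) : q ∈ Q}`. -/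
def fuzzySystem {X : Type u} (Q : Set (X → ℝ)) (a b : ℝ) : Set (Set X × Set X) :=
  (fun q : X → ℝ => ({x | q x ≤ a}, {x | b ≤ q x})) '' Q

open Classical in
/-- The subsets `J` of `Fin m` such that some `a` satisfies `lo a` on the points of `c` indexed
by `J` and `hi a` on all the other points of `c`. -/
noncomputable def fuzzyTraces {α β : Type*} {m : ℕ} (lo hi : α → β → Prop) (c : Fin m → β) :
    Finset (Finset (Fin m)) :=
  {J | ∃ a, (∀ i ∈ J, lo a (c i)) ∧ ∀ i ∉ J, hi a (c i)}

theorem mem_fuzzyTraces {α β : Type*} {m : ℕ} {lo hi : α → β → Prop} {c : Fin m → β}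
    {J : Finset (Fin m)} :
    J ∈ fuzzyTraces lo hi c ↔ ∃ a, (∀ i ∈ J, lo a (c i)) ∧ ∀ i ∉ J, hi a (c i) := by
  simp [fuzzyTraces]

/-- A polynomial form of the Sauer–Shelah lemma. -/
theorem Finset.card_le_of_forall_not_shatters {m d : ℕ} {𝒜 : Finset (Finset (Fin m))}
    (h : ∀ S : Finset (Fin m), S.card = d + 1 → ¬ 𝒜.Shatters S) :
    𝒜.card ≤ (m + 1) ^ d := by
  have hd : 𝒜.vcDim ≤ d := by
    refine Finset.sup_le fun S hS => ?_
    by_contra! hlt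
    obtain ⟨T, hTS, hT⟩ := Finset.exists_subset_card_eq (Nat.succ_le_of_lt hlt)
    exact h T hT ((Finset.mem_shatterer.1 hS).mono_right hTS)
  calc 𝒜.card ≤ ∑ k ∈ Finset.Iic 𝒜.vcDim, (Fintype.card (Fin m)).choose k :=
        (Finset.card_le_card_shatterer 𝒜).trans Finset.card_shatterer_le_sum_vcDim
    _ ≤ ∑ k ∈ Finset.range (d + 1), m.choose k := by
        rw [Fintype.card_fin]
        refine Finset.sum_le_sum_of_subset fun k hk => ?_
        simp only [Finset.mem_Iic, Finset.mem_range] at *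
        omega
    _ ≤ ∑ k ∈ Finset.range (d + 1), m ^ k * 1 ^ (d - k) * d.choose k := by
        refine Finset.sum_le_sum fun k hk => ?_
        have hk' : 1 ≤ d.choose k :=
          Nat.choose_pos (Nat.lt_succ_iff.1 (Finset.mem_range.1 hk))
        rw [one_pow, mul_one]
        exact (Nat.choose_le_pow m k).trans (Nat.le_mul_of_pos_right _ hk')
    _ = (m + 1) ^ d := by simp [add_pow]

/-- The fuzzy Sauer–Shelah lemma. -/
theorem card_fuzzyTraces_le {α β : Type*} {m d : ℕ} {lo hi : α → β → Prop} {c : Fin m → β}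
    (disj : ∀ a i, lo a (c i) → ¬ hi a (c i))
    (h : ∀ G : Finset β, ↑G ⊆ Set.range c → G.card = d + 1 →
      ¬ ∀ W ⊆ G, ∃ a, (∀ b ∈ G, (lo a b ↔ b ∈ W)) ∧ ∀ b ∈ G, (hi a b ↔ b ∉ W)) :
    (fuzzyTraces lo hi c).card ≤ (m + 1) ^ d := by
  classical
  refine Finset.card_le_of_forall_not_shatters fun S hS hsh => ?_
  have key : ∀ T ⊆ S, ∃ a, (∀ i ∈ S, (lo a (c i) ↔ i ∈ T)) ∧
      ∀ i ∈ S, (hi a (c i) ↔ i ∉ T) := by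
    intro T hT
    obtain ⟨U, hU, rfl⟩ := hsh hT
    obtain ⟨a, hlo, hhi⟩ := mem_fuzzyTraces.1 hU
    refine ⟨a, fun i hi => ?_, fun i hi => ?_⟩ <;>
    · have := hlo i
      have := hhi i
      have := disj a i
      simp only [Finset.mem_inter, hi, true_and]
      tauto
  have hinj : Set.InjOn c S := by
    intro i hi j hj hij
    obtain ⟨a, ha, -⟩ := key {i} (by simpa using hi)
    have h1 := (ha i hi).2 (by simp)
    rw [hij] at h1
    exact (Finset.mem_singleton.1 ((ha j hj).1 h1)).symm
  refine h (S.image c) (by simp [Set.subset_def]) (by rw [Finset.card_image_of_injOn hinj, hS])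
    fun W _ => ?_
  obtain ⟨a, hlo, hhi⟩ := key (S.filter fun i => c i ∈ W) (Finset.filter_subset _ _)
  refine ⟨a, ?_, ?_⟩ <;>
  · intro b hb
    obtain ⟨i, hi, rfl⟩ := Finset.mem_image.1 hb
    simp [hlo i hi, hhi i hi, hi]

/-- Resampling one coordinate does not change an expectation with respect to a product weight. -/
theorem sum_prod_mul_update {m : ℕ} {ι : Type*} [Fintype ι] (w : ι → ℝ) (hw : ∑ a, w a = 1)
    (i : Fin m) (φ : (Fin m → ι) → ℝ) :
    ∑ e : Fin m → ι, (∏ j, w (e j)) * φ e =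
      ∑ e : Fin m → ι, (∏ j, w (e j)) * ∑ a, w a * φ (Function.update e i a) := by
  classical
  have hswap : ∑ x : (Fin m → ι) × ι, (∏ j, w (x.1 j)) * (w x.2 * φ x.1) =
      ∑ x : (Fin m → ι) × ι, (∏ j, w (x.1 j)) * (w x.2 * φ (Function.update x.1 i x.2)) := by
    let σ : (Fin m → ι) × ι → (Fin m → ι) × ι := fun x => (Function.update x.1 i x.2, x.1 i)
    have hσ : Function.Involutive σ := fun x => by simp [σ]
    refine (Fintype.sum_equiv hσ.toPerm _ _ fun x => ?_).symm
    have hprod : (∏ j, w (Function.update x.1 i x.2 j)) * w (x.1 i) =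
        (∏ j, w (x.1 j)) * w x.2 := by
      rw [← Finset.mul_prod_erase _ _ (Finset.mem_univ i),
        ← Finset.mul_prod_erase Finset.univ (fun j => w (x.1 j)) (Finset.mem_univ i)]
      have : ∏ j ∈ Finset.univ.erase i, w (Function.update x.1 i x.2 j) =
          ∏ j ∈ Finset.univ.erase i, w (x.1 j) :=
        Finset.prod_congr rfl fun j hj => by
          rw [Function.update_of_ne (Finset.ne_of_mem_erase hj)]
      rw [this, Function.update_self]
      ring
    simp only [Function.Involutive.coe_toPerm, σ]
    rw [← mul_assoc, ← mul_assoc, hprod]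
  simp only [Fintype.sum_prod_type] at hswap
  simp only [Finset.mul_sum]
  rw [← hswap]
  refine Finset.sum_congr rfl fun e _ => ?_
  rw [← Finset.mul_sum, ← Finset.sum_mul, hw, one_mul]

theorem sum_prod_eq_one {m : ℕ} {ι : Type*} [Fintype ι] (w : ι → ℝ) (hw : ∑ a, w a = 1) :
    ∑ e : Fin m → ι, ∏ j, w (e j) = 1 := by
  have := Fintype.sum_pow w m
  rw [← this, hw, one_pow]

open Classical in
/-- If `S e` does not depend on the coordinates in `Z` and always has weight at least `β`, then
with probability at least `β ^ #Z` all coordinates of `e` in `Z` belong to `S e`. -/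
theorem pow_card_le_sum_prod {m : ℕ} {ι : Type*} [Fintype ι] (w : ι → ℝ) (hw0 : ∀ a, 0 ≤ w a)
    (hw : ∑ a, w a = 1) {β : ℝ} (hβ : 0 ≤ β) (S : (Fin m → ι) → Finset ι)
    (hS : ∀ e, β ≤ ∑ a ∈ S e, w a) (Z : Finset (Fin m))
    (hZ : ∀ e, ∀ i ∈ Z, ∀ a, S (Function.update e i a) = S e) :
    β ^ Z.card ≤ ∑ e : Fin m → ι, (∏ j, w (e j)) * if ∀ j ∈ Z, e j ∈ S e then 1 else 0 := by
  induction Z using Finset.induction_on with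
  | empty => simp [sum_prod_eq_one w hw]
  | insert i Z hi ih =>
    have ih' := ih fun e j hj => hZ e j (Finset.mem_insert_of_mem hj)
    rw [Finset.card_insert_of_notMem hi, pow_succ,
      sum_prod_mul_update w hw i]
    refine (mul_le_mul_of_nonneg_right ih' hβ).trans ?_
    rw [Finset.sum_mul]
    refine Finset.sum_le_sum fun e _ => ?_
    rw [mul_assoc]
    refine mul_le_mul_of_nonneg_left ?_ (Finset.prod_nonneg fun j _ => hw0 _)
    by_cases h : ∀ j ∈ Z, e j ∈ S e
    · rw [if_pos h, one_mul]
      refine (hS e).trans (le_of_eq ?_)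
      have hiff : ∀ a, (∀ j ∈ insert i Z, Function.update e i a j ∈ S (Function.update e i a)) ↔
          a ∈ S e := by
        intro a
        rw [hZ e i (Finset.mem_insert_self _ _), Finset.forall_mem_insert, Function.update_self,
          and_iff_left]
        intro j hj
        rw [Function.update_of_ne (by rintro rfl; exact hi hj)]
        exact h j hj
      simp only [hiff, mul_ite, mul_one, mul_zero]
      simp
    · rw [if_neg h, zero_mul]
      exact Finset.sum_nonneg fun a _ => mul_nonneg (hw0 a) (by split_ifs <;> norm_num)

open Classical in
/-- The fuzzy `ε`-net theorem. -/
theorem exists_small_net {α X Y : Type*} [Fintype Y] {d m : ℕ} (lo hi : α → X → Prop)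
    (htr : ∀ x : Fin m → X, (fuzzyTraces lo hi x).card ≤ (m + 1) ^ d)
    (pt : Y → X) (ν : Y → ℝ) (hν0 : ∀ y, 0 ≤ ν y) (hν : ∑ y, ν y = 1) {β : ℝ} (hβ : 0 ≤ β)
    (hlo : ∀ a, β ≤ ∑ y with lo a (pt y), ν y) (hm : ((m : ℝ) + 1) ^ d < (1 + β) ^ m) :
    ∃ A : Finset X, A.card ≤ m ∧ ∀ a, ∃ x ∈ A, ¬ hi a x := by
  by_contra! hcon
  have hF : ∀ A : Finset X, ∃ a, A.card ≤ m → ∀ x ∈ A, hi a x := by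
    intro A
    by_cases hA : A.card ≤ m
    · exact (hcon A hA).imp fun a ha _ => ha
    · exact (hcon ∅ (by simp)).imp fun a _ h => absurd h hA
  choose F hF using hF
  let f : Finset (Fin m) → (Fin m → Y) → α := fun Z x => F (Zᶜ.image (pt ∘ x))
  have hf : ∀ Z x, ∀ j ∉ Z, hi (f Z x) (pt (x j)) := fun Z x j hj =>
    hF _ (Finset.card_image_le.trans ((Finset.card_le_univ _).trans_eq (Fintype.card_fin m))) _
      (Finset.mem_image.2 ⟨j, by simpa using hj, rfl⟩)
  have hZ : ∀ Z, β ^ Z.card ≤ ∑ x : Fin m → Y, (∏ j, ν (x j)) *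
      if ∀ j ∈ Z, x j ∈ Finset.univ.filter (fun y => lo (f Z x) (pt y)) then 1 else 0 := by
    intro Z
    refine pow_card_le_sum_prod ν hν0 hν hβ
      (fun x => Finset.univ.filter (fun y => lo (f Z x) (pt y))) (fun x => hlo _) Z ?_
    intro x i hi a
    have : f Z (Function.update x i a) = f Z x := by
      refine congrArg F (Finset.image_congr fun j hj => ?_)
      have : j ≠ i := by rintro rfl; simp at hj; exact hj hi
      simp [Function.update_of_ne this]
    simp only [this]
  refine hm.not_ge ?_
  calc (1 + β) ^ m = ∑ Z : Finset (Fin m), β ^ Z.card := by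
        have := Finset.sum_pow_mul_eq_add_pow β 1 (Finset.univ : Finset (Fin m))
        simpa [add_comm] using this.symm
    _ ≤ ∑ Z : Finset (Fin m), _ := Finset.sum_le_sum fun Z _ => hZ Z
    _ = ∑ x : Fin m → Y, (∏ j, ν (x j)) * ∑ Z : Finset (Fin m),
          if ∀ j ∈ Z, x j ∈ Finset.univ.filter (fun y => lo (f Z x) (pt y)) then 1 else 0 := by
        rw [Finset.sum_comm]
        simp only [Finset.mul_sum]
    _ ≤ ∑ x : Fin m → Y, (∏ j, ν (x j)) * ((m : ℝ) + 1) ^ d := by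
        refine Finset.sum_le_sum fun x _ =>
          mul_le_mul_of_nonneg_left ?_ (Finset.prod_nonneg fun j _ => hν0 _)
        rw [Finset.sum_boole]
        refine le_trans ?_ (Nat.cast_le (α := ℝ).2 (htr (pt ∘ x)) |>.trans_eq (by push_cast; rfl))
        refine Nat.cast_le.2 (Finset.card_le_card fun Z hZ => ?_)
        refine mem_fuzzyTraces.2 ⟨f Z x, ?_, fun j hj => hf Z x j hj⟩
        simpa using hZ
    _ = ((m : ℝ) + 1) ^ d := by rw [← Finset.sum_mul, sum_prod_eq_one ν hν, one_mul]

/-- A lower bound on the size of a family of `k`-sets meeting the power set of every `p`-set. -/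
theorem choose_le_card_mul_pow {m p k : ℕ} (𝒢 : Finset (Finset (Fin m)))
    (h : ∀ P : Finset (Fin m), P.card = p → ∃ J ∈ 𝒢, J ⊆ P ∧ J.card = k) :
    m.choose p ≤ 𝒢.card * m ^ (p - k) := by
  classical
  have hsub : Finset.powersetCard p (Finset.univ : Finset (Fin m)) ⊆ 𝒢.biUnion fun J =>
      (Finset.powersetCard (p - k) Finset.univ).image (J ∪ ·) := by
    intro P hP
    obtain ⟨J, hJ, hJP, hJk⟩ := h P (Finset.mem_powersetCard.1 hP).2
    refine Finset.mem_biUnion.2 ⟨J, hJ, Finset.mem_image.2 ⟨P \ J, ?_, ?_⟩⟩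
    · rw [Finset.mem_powersetCard, Finset.card_sdiff_of_subset hJP, hJk,
        (Finset.mem_powersetCard.1 hP).2]
      exact ⟨Finset.subset_univ _, rfl⟩
    · exact Finset.union_sdiff_of_subset hJP
  have := (Finset.card_le_card hsub).trans (Finset.card_biUnion_le_card_mul _ _ (m ^ (p - k))
    fun J _ => Finset.card_image_le.trans ?_)
  · simpa using this
  · simpa using Nat.choose_le_pow m (p - k)

/-- For fixed `d < p` and large `m`, the binomial coefficient `m.choose p` exceeds a given
polynomial in `m` of degree `p - 1`. -/
theorem exists_pow_mul_pow_lt_choose {d p : ℕ} (hp : d + 1 ≤ p) :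
    ∃ m : ℕ, (m + 1) ^ d * m ^ (p - (d + 1)) < m.choose p := by
  set c := p.factorial * (2 * p) ^ (p - 1) + 1 with hc
  refine ⟨p - 1 + c, ?_⟩
  by_contra! hle
  set m := p - 1 + c with hm
  have hmc : m + 1 ≤ 2 * p * c := by
    have h1 : p ≤ p * c := Nat.le_mul_of_pos_right _ (by omega)
    have h2 : c ≤ p * c := Nat.le_mul_of_pos_left _ (by omega)
    have h3 : 2 * p * c = p * c + p * c := by ring
    omega
  have h1 : c ^ p ≤ p.factorial * m.choose p := by
    rw [← Nat.descFactorial_eq_factorial_mul_choose]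
    have := Nat.pow_sub_le_descFactorial m p
    rwa [show m + 1 - p = c by omega] at this
  have h2 : m.choose p ≤ (2 * p * c) ^ (p - 1) := by
    calc m.choose p ≤ (m + 1) ^ d * m ^ (p - (d + 1)) := hle
      _ ≤ (2 * p * c) ^ d * (2 * p * c) ^ (p - (d + 1)) := by gcongr; omega
      _ = (2 * p * c) ^ (p - 1) := by rw [← pow_add]; congr 1; omega
  have h3 : c * c ^ (p - 1) ≤ (c - 1) * c ^ (p - 1) := by
    calc c * c ^ (p - 1) = c ^ p := by rw [← pow_succ']; congr 1; omega
      _ ≤ p.factorial * (2 * p * c) ^ (p - 1) := h1.trans (Nat.mul_le_mul_left _ h2)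
      _ = (c - 1) * c ^ (p - 1) := by rw [mul_pow, ← mul_assoc, hc, Nat.add_sub_cancel]
  have := Nat.le_of_mul_le_mul_right h3 (pow_pos (by omega) _)
  omega

open Classical in
/-- A weighted fuzzy fractional Helly theorem. -/
theorem exists_heavy_point {ι X : Type*} [Fintype ι] {d p m : ℕ} (lo hi : X → ι → Prop)
    (htr : ∀ e : Fin m → ι, (fuzzyTraces lo hi e).card ≤ (m + 1) ^ d)
    (hpq : ∀ g : Fin p → ι, ∃ I : Finset (Fin p), I.card = d + 1 ∧ ∃ x, ∀ i ∈ I, lo x (g i))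
    (hm : (m + 1) ^ d * m ^ (p - (d + 1)) < m.choose p)
    (w : ι → ℝ) (hw0 : ∀ i, 0 ≤ w i) (hw : ∑ i, w i = 1) :
    ∃ x, 1 / (2 ^ m * (m + 1) : ℝ) ≤ ∑ i with ¬ hi x i, w i := by
  by_contra! hlt
  have hι : Nonempty ι := by
    by_contra hι
    rw [not_nonempty_iff] at hι
    simp at hw
  obtain ⟨-, -, x₀, -⟩ := hpq fun _ => hι.some
  have hF : ∀ S : Finset ι, ∃ x, (∃ y, ∀ i ∈ S, lo y i) → ∀ i ∈ S, lo x i := by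
    intro S
    by_cases hS : ∃ y, ∀ i ∈ S, lo y i
    · exact hS.imp fun y hy _ => hy
    · exact ⟨x₀, fun h => absurd h hS⟩
  choose F hF using hF
  obtain ⟨e, he⟩ : ∃ e : Fin m → ι, ∀ J : Finset (Fin m), ∀ i ∉ J, hi (F (J.image e)) (e i) := by
    by_contra! hbad
    let φ : Finset (Fin m) × Fin m → (Fin m → ι) → ℝ := fun z e =>
      if z.2 ∉ z.1 ∧ ¬ hi (F (z.1.image e)) (e z.2) then 1 else 0
    have hφ : ∀ z, ∑ e : Fin m → ι, (∏ j, w (e j)) * φ z e ≤ 1 / (2 ^ m * (m + 1) : ℝ) := by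
      rintro ⟨J, i⟩
      by_cases hiJ : i ∈ J
      · simp only [φ, hiJ, not_true, false_and, if_false, mul_zero, Finset.sum_const_zero]
        positivity
      rw [sum_prod_mul_update w hw i]
      calc _ ≤ ∑ e : Fin m → ι, (∏ j, w (e j)) * (1 / (2 ^ m * (m + 1) : ℝ)) := by
            refine Finset.sum_le_sum fun e _ =>
              mul_le_mul_of_nonneg_left ?_ (Finset.prod_nonneg fun j _ => hw0 _)
            refine le_trans (le_of_eq ?_) (hlt (F (J.image e))).le
            rw [Finset.sum_filter]
            refine Finset.sum_congr rfl fun a _ => ?_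
            have himg : J.image (Function.update e i a) = J.image e :=
              Finset.image_congr fun j hj =>
                Function.update_of_ne (by rintro rfl; exact hiJ hj) _ _
            simp [φ, himg, hiJ]
        _ = _ := by rw [← Finset.sum_mul, sum_prod_eq_one w hw, one_mul]
    have hone : (1 : ℝ) ≤ ∑ z, ∑ e : Fin m → ι, (∏ j, w (e j)) * φ z e := by
      rw [Finset.sum_comm, ← sum_prod_eq_one (m := m) w hw]
      refine Finset.sum_le_sum fun e _ => ?_
      rw [← Finset.mul_sum]
      refine le_mul_of_one_le_right (Finset.prod_nonneg fun j _ => hw0 _) ?_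
      obtain ⟨J, i, hiJ, hi⟩ := hbad e
      have h1 : φ (J, i) e = 1 := if_pos ⟨hiJ, hi⟩
      rw [← h1]
      exact Finset.single_le_sum (f := fun z => φ z e)
        (fun z _ => by simp only [φ]; split_ifs <;> norm_num) (Finset.mem_univ _)
    have hsum := hone.trans (Finset.sum_le_sum fun z _ => hφ z)
    rw [Finset.sum_const, Finset.card_univ, Fintype.card_prod, Fintype.card_finset,
      Fintype.card_fin, nsmul_eq_mul, mul_one_div, le_div_iff₀ (by positivity)] at hsum
    push_cast at hsum
    have : (0 : ℝ) < 2 ^ m := by positivity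
    linarith
  have hgood := choose_le_card_mul_pow (p := p) (k := d + 1) (fuzzyTraces lo hi e) fun P hP => by
    obtain ⟨I, hI, x, hx⟩ := hpq (e ∘ P.orderEmbOfFin hP)
    refine ⟨I.map (P.orderEmbOfFin hP).toEmbedding, mem_fuzzyTraces.2
      ⟨F ((I.map (P.orderEmbOfFin hP).toEmbedding).image e), fun i hi => ?_, he _⟩, ?_, ?_⟩
    · refine hF _ ⟨x, ?_⟩ _ (Finset.mem_image_of_mem e hi)
      simpa using hx
    · intro j hj
      obtain ⟨i, -, rfl⟩ := Finset.mem_map.1 hj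
      exact P.orderEmbOfFin_mem hP i
    · rw [Finset.card_map, hI]
  exact (hgood.trans (Nat.mul_le_mul_right _ (htr e))).not_gt hm

open Classical in
/-- The minimax form of linear programming duality for a relation `b`. -/
theorem exists_weight_of_forall_weight {ι X : Type*} [Fintype ι] [Nonempty X] (b : X → ι → Prop)
    (β : ℝ) (h : ∀ w : ι → ℝ, (∀ i, 0 ≤ w i) → ∑ i, w i = 1 → ∃ x, β ≤ ∑ i with b x i, w i) :
    ∃ (Y : Type) (_ : Fintype Y) (pt : Y → X) (ν : Y → ℝ), (∀ y, 0 ≤ ν y) ∧ ∑ y, ν y = 1 ∧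
      ∀ i, β ≤ ∑ y with b (pt y) i, ν y := by
  let v : X → ι → ℝ := fun x i => if b x i then 1 else 0
  have hfin : (Set.range v).Finite := by
    refine (Set.finite_range fun (s : Set ι) i => if i ∈ s then (1 : ℝ) else 0).subset ?_
    rintro _ ⟨x, rfl⟩
    exact ⟨{i | b x i}, rfl⟩
  have hmeet : ¬ Disjoint (convexHull ℝ (Set.range v)) (Set.Ici fun _ : ι => β) := by
    intro hdis
    obtain ⟨φ, u, u', hu, huu', hu'⟩ := geometric_hahn_banach_compact_closed
      (convex_convexHull ℝ _) (hfin.isCompact_convexHull ℝ) (convex_Ici _) isClosed_Ici hdis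
    let w : ι → ℝ := fun i => φ (Pi.single i 1)
    have hφ : ∀ z : ι → ℝ, φ z = ∑ i, z i * w i := by
      intro z
      conv_lhs => rw [pi_eq_sum_univ' z]
      simp [w, map_sum, map_smul]
    have hwsum : ∀ x, φ (v x) = ∑ i with b x i, w i := by
      intro x
      simp [hφ, v, Finset.sum_filter]
    have hux : ∀ x, φ (v x) < u := fun x => hu _ (subset_convexHull ℝ _ ⟨x, rfl⟩)
    have hφβ : φ (fun _ => β) = β * ∑ i, w i := by rw [hφ, Finset.mul_sum]
    have hβ : u' < β * ∑ i, w i := hφβ ▸ hu' _ Set.self_mem_Ici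
    have hw0 : ∀ i, 0 ≤ w i := by
      intro i
      by_contra! hneg
      have hM : 0 ≤ (u' - β * ∑ i, w i) / w i :=
        div_nonneg_of_nonpos (by linarith) hneg.le
      have := hu' ((fun _ => β) + ((u' - β * ∑ i, w i) / w i) • Pi.single i 1) (by
        rw [Set.mem_Ici]
        exact le_add_of_nonneg_right (smul_nonneg hM (Pi.single_nonneg.2 zero_le_one)))
      rw [map_add, map_smul, hφβ, smul_eq_mul] at this
      have hcancel : (u' - β * ∑ i, w i) / w i * φ (Pi.single i 1) = u' - β * ∑ i, w i :=
        div_mul_cancel₀ _ hneg.ne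
      linarith
    have hW : 0 < ∑ i, w i := by
      refine lt_of_le_of_ne (Finset.sum_nonneg fun i _ => hw0 i) fun h0 => ?_
      have hx := hux (Classical.arbitrary X)
      have : 0 ≤ φ (v (Classical.arbitrary X)) := by
        rw [hwsum]
        exact Finset.sum_nonneg fun i _ => hw0 i
      rw [← h0, mul_zero] at hβ
      linarith
    obtain ⟨x, hx⟩ := h (fun i => w i / ∑ i, w i) (fun i => div_nonneg (hw0 i) hW.le)
      (by rw [← Finset.sum_div, div_self hW.ne'])
    rw [← Finset.sum_div, ← hwsum, le_div_iff₀ hW] at hx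
    linarith [hux x]
  obtain ⟨z, hz, hzβ⟩ := Set.not_disjoint_iff.1 hmeet
  obtain ⟨Y, hY, ν, pts, hν0, hν, hpts, rfl⟩ := mem_convexHull_iff_exists_fintype.1 hz
  choose pt hpt using hpts
  refine ⟨Y, hY, pt, ν, hν0, hν, fun i => ?_⟩
  have := hzβ i
  simpa [← hpt, v, Finset.sum_filter] using this

theorem exists_pow_lt_one_add_pow (d : ℕ) {β : ℝ} (hβ : 0 < β) :
    ∃ m : ℕ, ((m : ℝ) + 1) ^ d < (1 + β) ^ m := by
  have h := (tendsto_pow_const_div_const_pow_of_one_lt d (r := 1 + β) (by linarith)).comp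
    (Filter.tendsto_add_atTop_nat 1)
  obtain ⟨m, hm⟩ := (h.eventually_lt_const (u := 1 / (1 + β)) (by positivity)).exists
  refine ⟨m, ?_⟩
  simp only [Function.comp_apply] at hm
  rw [div_lt_div_iff₀ (by positivity) (by positivity), one_mul, pow_succ] at hm
  have := lt_of_mul_lt_mul_right hm (by positivity)
  exact_mod_cast this

/-- For all `0 ≤ r < t < s ≤ 1`, `d₁, d₂ ∈ ℕ` and `p ≥ q ≥ d₁ + 1` there is
`N = N(d₁,d₂,p,q)` such that: if `Q ⊆ [0,1]^X` is a finite function class with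
`vc*(Q_{r,t}) ≤ d₁` and `vc(Q_{t,s}) ≤ d₂`, and the set system `Q_{≤r}` has the
`(p,q)`-property, then `τ(Q_{<s}) ≤ N`, i.e. there is a transversal of
`Q_{<s}` of size at most `N`. -/
theorem stmt_8 (d₁ d₂ p q : ℕ) (hq : d₁ + 1 ≤ q) (hpq : q ≤ p) :
    ∃ N : ℕ, ∀ (X : Type u) (r t s : ℝ), 0 ≤ r → r < t → t < s → s ≤ 1 →
      ∀ Q : Set (X → ℝ), Q.Finite →
      (∀ f ∈ Q, ∀ x, f x ∈ Set.Icc (0 : ℝ) 1) →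
      (∀ G : Finset (Set X × Set X), G.card = d₁ + 1 →
        ¬ DualShatters (fuzzySystem Q r t) G) →
      (∀ Y : Finset X, Y.card = d₂ + 1 → ¬ FuzzyShatters (fuzzySystem Q t s) Y) →
      (∀ g : Fin p → Set X,
        (∀ i, g i ∈ (fun f : X → ℝ => {x | f x ≤ r}) '' Q) →
        ∃ I : Finset (Fin p), I.card = q ∧ (⋂ i ∈ I, g i).Nonempty) →
      ∃ A : Finset X, A.card ≤ N ∧ ∀ f ∈ Q, ∃ a ∈ A, f a < s := by
  obtain ⟨m₁, hm₁⟩ := exists_pow_mul_pow_lt_choose (hq.trans hpq)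
  obtain ⟨m₂, hm₂⟩ := exists_pow_lt_one_add_pow d₂
    (β := 1 / (2 ^ m₁ * (m₁ + 1) : ℝ)) (by positivity)
  refine ⟨m₂, fun X r t s _ hrt hts _ Q hQ _ hdual hvc hprop => ?_⟩
  have hmeet : ∀ g : Fin p → Q, ∃ I : Finset (Fin p), I.card = d₁ + 1 ∧
      ∃ x, ∀ i ∈ I, (g i).1 x ≤ r := by
    intro g
    obtain ⟨I, hI, x, hx⟩ := hprop (fun i => {x | (g i).1 x ≤ r}) fun i => ⟨_, (g i).2, rfl⟩
    obtain ⟨J, hJI, hJ⟩ := Finset.exists_subset_card_eq (hq.trans_eq hI.symm)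
    exact ⟨J, hJ, x, fun i hi => Set.mem_iInter₂.1 hx i (hJI hi)⟩
  obtain rfl | ⟨f₀, hf₀⟩ := Q.eq_empty_or_nonempty
  · exact ⟨∅, by simp, by simp⟩
  obtain ⟨-, -, x₀, -⟩ := hmeet fun _ => ⟨f₀, hf₀⟩
  have : Nonempty X := ⟨x₀⟩
  have : Fintype Q := hQ.fintype
  have hdualTraces : ∀ {m : ℕ} (e : Fin m → Q), (fuzzyTraces (fun (x : X) (f : Q) => f.1 x ≤ r)
      (fun x f => t ≤ f.1 x) e).card ≤ (m + 1) ^ d₁ := by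
    intro m e
    let fz : Fin m → Set X × Set X := fun i => ({x | (e i).1 x ≤ r}, {x | t ≤ (e i).1 x})
    refine card_fuzzyTraces_le (lo := fun (x : X) S => x ∈ S.1) (hi := fun x S => x ∈ S.2)
      (c := fz) (fun x i (h : (e i).1 x ≤ r) (h' : t ≤ (e i).1 x) => by linarith)
      fun G hG hcard hsh => hdual G hcard ⟨hG.trans ?_, hsh⟩
    rintro _ ⟨i, rfl⟩
    exact ⟨_, (e i).2, rfl⟩
  have hvcTraces : ∀ {m : ℕ} (c : Fin m → X), (fuzzyTraces (fun (f : Q) x => f.1 x ≤ t)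
      (fun (f : Q) x => s ≤ f.1 x) c).card ≤ (m + 1) ^ d₂ := by
    intro m c
    refine card_fuzzyTraces_le (fun f i h => by linarith) fun Y _ hcard hsh => hvc Y hcard ?_
    intro Z hZ
    obtain ⟨f, hf⟩ := hsh Z hZ
    exact ⟨_, ⟨f, f.2, rfl⟩, hf⟩
  obtain ⟨Y, _, pt, ν, hν0, hν, hβ⟩ := exists_weight_of_forall_weight
    (fun (x : X) (f : Q) => ¬ t ≤ f.1 x) (1 / (2 ^ m₁ * (m₁ + 1) : ℝ))
    fun w hw0 hw => (exists_heavy_point (fun (x : X) (f : Q) => f.1 x ≤ r) _ hdualTraces hmeet hm₁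
      w hw0 hw).imp fun x hx => hx.trans_eq (by congr!)
  have hlo (f : Q) : 1 / (2 ^ m₁ * (m₁ + 1) : ℝ) ≤ ∑ y with f.1 (pt y) ≤ t, ν y := by
    refine (hβ f).trans (Finset.sum_le_sum_of_subset_of_nonneg (fun y hy => ?_) fun y _ _ => hν0 y)
    simp only [Finset.mem_filter, Finset.mem_univ, true_and, not_le] at hy ⊢
    exact hy.le
  obtain ⟨A, hA, hnet⟩ := exists_small_net (fun (f : Q) x => f.1 x ≤ t) (fun (f : Q) x => s ≤ f.1 x)
    hvcTraces pt ν hν0 hν (by positivity) (fun f => (hlo f).trans_eq (by congr!)) hm₂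
  exact ⟨A, hA, fun f hf => (hnet ⟨f, hf⟩).imp fun a ha => ⟨ha.1, not_le.1 ha.2⟩⟩
end

section
/- Let (aₙ : n < ω) be a sequence in [0,1] and let b ∈ [0,1]. If b − 2^{−n} ≤ aₙ for all n, then b ≤ 𝓕lim aₙ, the forced limit of the sequence. -/
open scoped Classical

/-- The auxiliary sequence `(cₙ)` of the forced limit construction:
`c₀ = a₀`, and `c_{n+1}` is `c_n + 2^{-n-1}`, `a_{n+1}`, or `c_n - 2^{-n-1}`
according to whether `a_{n+1}` is above, within, or below distance `2^{-n-1}`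
of `c_n`.  The forced limit `𝓕lim aₙ` is `lim cₙ`. -/
noncomputable def flimAux (a : ℕ → ℝ) : ℕ → ℝ
  | 0 => a 0
  | n + 1 =>
      let c := flimAux a n
      if c + (1 / 2 : ℝ) ^ (n + 1) ≤ a (n + 1) then c + (1 / 2 : ℝ) ^ (n + 1)
      else if a (n + 1) ≤ c - (1 / 2 : ℝ) ^ (n + 1) then c - (1 / 2 : ℝ) ^ (n + 1)
      else a (n + 1)

theorem flimAux_dist_succ_le (a : ℕ → ℝ) (n : ℕ) :
    dist (flimAux a n) (flimAux a (n + 1)) ≤ (1 / 2 : ℝ) ^ (n + 1) := by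
  have hp : (0 : ℝ) < (1 / 2 : ℝ) ^ (n + 1) := by positivity
  rw [Real.dist_eq, abs_le]
  simp only [flimAux]
  split_ifs <;> constructor <;> linarith

theorem sub_pow_le_flimAux {a : ℕ → ℝ} {b : ℝ} (h : ∀ n, b - (1 / 2 : ℝ) ^ n ≤ a n) (n : ℕ) :
    b - (1 / 2 : ℝ) ^ n ≤ flimAux a n := by
  induction n with
  | zero => exact h 0
  | succ n ih =>
    have ha := h (n + 1)
    have hp : (1 / 2 : ℝ) ^ n = 2 * (1 / 2 : ℝ) ^ (n + 1) := by ring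
    simp only [flimAux]
    split_ifs <;> linarith

/-- If `b - 2^{-n} ≤ aₙ` for all `n`, then `b ≤ 𝓕lim aₙ`:
the forced-limit auxiliary sequence converges to some limit `L` with `b ≤ L`. -/
theorem stmt_9 (a : ℕ → ℝ) (ha : ∀ n, a n ∈ Set.Icc (0 : ℝ) 1)
    (b : ℝ) (hb : b ∈ Set.Icc (0 : ℝ) 1)
    (h : ∀ n, b - (1 / 2 : ℝ) ^ n ≤ a n) :
    ∃ L : ℝ, Filter.Tendsto (flimAux a) Filter.atTop (nhds L) ∧ b ≤ L := by
  have hc : CauchySeq (flimAux a) := by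
    refine cauchySeq_of_le_geometric (1 / 2) (1 / 2) (by norm_num) fun n => ?_
    simpa only [pow_succ'] using flimAux_dist_succ_le a n
  obtain ⟨L, hL⟩ := cauchySeq_tendsto_of_complete hc
  refine ⟨L, hL, ?_⟩
  have hlim : Filter.Tendsto (fun n : ℕ => b - (1 / 2 : ℝ) ^ n) Filter.atTop (nhds (b - 0)) :=
    tendsto_const_nhds.sub
      (tendsto_pow_atTop_nhds_zero_of_lt_one (by norm_num) (by norm_num))
  simpa using le_of_tendsto_of_tendsto' hlim hL (sub_pow_le_flimAux h)
end
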